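/- Let F_C ⊆ ℝ^d be an inhomogeneous self-similar set with the notation s, α, β, γ as given, and assume γ = 0 (which holds whenever the orthogonal parts commute, or d = 1, or d = 2). Then the upper box dimension of F_C is at most max{ β, α + β − αβ/s }. -/

import Mathlib

open Filter

/-- The number of cubes from the `δ`-mesh on `ℝ^d` (products of half-open intervals
`[aδ, (a+1)δ)`, `a ∈ ℤ`) that intersect `E`. -/
noncomputable def meshCount (d : ℕ) (δ : ℝ) (E : Set (Fin d → ℝ)) : ℕ :=
  Set.ncard {a : Fin d → ℤ | ∃ x ∈ E, ∀ i, (a i : ℝ) * δ ≤ x i ∧ x i < ((a i : ℝ) + 1) * δ}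

/-- The upper box dimension of `E ⊆ ℝ^d`. -/
noncomputable def upperBoxDim (d : ℕ) (E : Set (Fin d → ℝ)) : ℝ :=
  Filter.limsup (fun δ : ℝ => Real.log (meshCount d δ E) / (-Real.log δ))
    (nhdsWithin 0 (Set.Ioi 0))

/-- The contraction ratio `c_I = c_{i₁} ⋯ c_{i_k}` of a finite word `I`. -/
def wordC {m : ℕ} (c : Fin m → ℝ) (I : List (Fin m)) : ℝ := (I.map c).prod

/-- The orthogonal part `M_{i₁} ⋯ M_{i_k}` of a finite word `I`. -/
def wordM {d m : ℕ} (M : Fin m → Matrix (Fin d) (Fin d) ℝ) (I : List (Fin m)) :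
    Matrix (Fin d) (Fin d) ℝ := (I.map M).prod

/-- The composition `S_I = S_{i₁} ∘ ⋯ ∘ S_{i_k}` along a finite word `I`. -/
def wordS {m : ℕ} {X : Type*} (S : Fin m → X → X) (I : List (Fin m)) : X → X :=
  I.foldr (fun i f => S i ∘ f) id

/-- `I_k`: the set of finite words `I` with `2^{-k-1} < c_I ≤ 2^{-k}`. -/
def wordIdx {m : ℕ} (c : Fin m → ℝ) (k : ℕ) : Set (List (Fin m)) :=
  {I | ((2 : ℝ) ^ (k + 1))⁻¹ < wordC c I ∧ wordC c I ≤ ((2 : ℝ) ^ k)⁻¹}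

/-- The set of maps `{T_I : I ∈ I_k}`, where `T_I(x) = c_I M_{i₁} ⋯ M_{i_k} x`. -/
def Tmaps (d m : ℕ) (c : Fin m → ℝ) (M : Fin m → Matrix (Fin d) (Fin d) ℝ) (k : ℕ) :
    Set ((Fin d → ℝ) → (Fin d → ℝ)) :=
  {f | ∃ I ∈ wordIdx c k, f = fun x => wordC c I • (wordM M I).mulVec x}

/-- `E` is covered by at most `K` closed balls of radius `r`. -/
def HasCover {X : Type*} [PseudoMetricSpace X] (E : Set X) (r K : ℝ) : Prop :=
  ∃ P : Finset X, (P.card : ℝ) ≤ K ∧ ∀ x ∈ E, ∃ p ∈ P, dist x p ≤ r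

namespace HasCover

variable {X : Type*} [PseudoMetricSpace X] {E E' : Set X} {r r' K K' : ℝ}

theorem mono (h : HasCover E r K) (hE : E' ⊆ E) (hr : r ≤ r') (hK : K ≤ K') :
    HasCover E' r' K' := by
  obtain ⟨P, hP, hcov⟩ := h
  refine ⟨P, hP.trans hK, fun x hx => ?_⟩
  obtain ⟨p, hp, hd⟩ := hcov x (hE hx)
  exact ⟨p, hp, hd.trans hr⟩

theorem union (h : HasCover E r K) (h' : HasCover E' r K') : HasCover (E ∪ E') r (K + K') := by
  classical
  obtain ⟨P, hP, hcov⟩ := h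
  obtain ⟨P', hP', hcov'⟩ := h'
  refine ⟨P ∪ P', ?_, ?_⟩
  · have : ((P ∪ P').card : ℝ) ≤ P.card + P'.card := mod_cast Finset.card_union_le P P'
    linarith
  · rintro x (hx | hx)
    · obtain ⟨p, hp, hd⟩ := hcov x hx
      exact ⟨p, Finset.mem_union_left _ hp, hd⟩
    · obtain ⟨p, hp, hd⟩ := hcov' x hx
      exact ⟨p, Finset.mem_union_right _ hp, hd⟩

theorem biUnion {ι : Type*} (t : Finset ι) {F : ι → Set X} (h : ∀ i ∈ t, HasCover (F i) r K) :
    HasCover (⋃ i ∈ t, F i) r (t.card * K) := by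
  classical
  induction t using Finset.induction_on with
  | empty => exact ⟨∅, by simp, by simp⟩
  | insert a t ha ih =>
    rw [Finset.set_biUnion_insert, Finset.card_insert_of_notMem ha]
    refine ((h a (Finset.mem_insert_self a t)).union
      (ih fun i hi => h i (Finset.mem_insert_of_mem hi))).mono subset_rfl le_rfl ?_
    push_cast
    linarith

end HasCover

theorem meshSet_finite_and_meshCount_le {d : ℕ} {E : Set (Fin d → ℝ)} {r K δ : ℝ} (hr : 0 ≤ r)
    (hδ : 0 < δ) (h : HasCover E r K) :
    {a : Fin d → ℤ | ∃ x ∈ E, ∀ i, (a i : ℝ) * δ ≤ x i ∧ x i < ((a i : ℝ) + 1) * δ}.Finite ∧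
      (meshCount d δ E : ℝ) ≤ K * (2 * (r / δ) + 2) ^ d := by
  classical
  obtain ⟨P, hP, hcov⟩ := h
  have hB : {a : Fin d → ℤ | ∃ x ∈ E, ∀ i, (a i : ℝ) * δ ≤ x i ∧ x i < ((a i : ℝ) + 1) * δ} ⊆
      ((P.biUnion fun p => Finset.Icc (fun i => ⌊(p i - r) / δ⌋) (fun i => ⌊(p i + r) / δ⌋) :
        Finset (Fin d → ℤ)) : Set (Fin d → ℤ)) := by
    rintro a ⟨x, hx, ha⟩
    obtain ⟨p, hp, hd⟩ := hcov x hx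
    simp only [Finset.coe_biUnion, Set.mem_iUnion, Finset.mem_coe, Finset.mem_Icc]
    refine ⟨p, hp, fun i => ?_, fun i => ?_⟩ <;>
    · have h1 := (dist_le_pi_dist x p i).trans hd
      rw [Real.dist_eq, abs_le] at h1
      have h2 := ha i
      first
      | exact Int.le_floor.2 ((le_div_iff₀ hδ).2 (by linarith))
      | refine Int.lt_add_one_iff.1 (Int.floor_lt.2 ((div_lt_iff₀ hδ).2 ?_))
        push_cast
        linarith
  refine ⟨(Finset.finite_toSet _).subset hB, ?_⟩
  have hcard : ∀ p : Fin d → ℝ,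
      ((Finset.Icc (fun i => ⌊(p i - r) / δ⌋) (fun i => ⌊(p i + r) / δ⌋) :
        Finset (Fin d → ℤ)).card : ℝ) ≤ (2 * (r / δ) + 2) ^ d := by
    intro p
    rw [Pi.card_Icc]
    push_cast
    refine (Finset.prod_le_prod (fun i _ => by positivity) (fun i _ => ?_)).trans_eq
      (by rw [Finset.prod_const, Finset.card_univ, Fintype.card_fin])
    rw [Int.card_Icc]
    have h1 : ⌊(p i - r) / δ⌋ ≤ ⌊(p i + r) / δ⌋ :=
      Int.floor_le_floor (by gcongr; linarith)
    have h2 : ((⌊(p i + r) / δ⌋ + 1 - ⌊(p i - r) / δ⌋).toNat : ℝ) =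
        (⌊(p i + r) / δ⌋ : ℝ) + 1 - ⌊(p i - r) / δ⌋ := by
      have : ((⌊(p i + r) / δ⌋ + 1 - ⌊(p i - r) / δ⌋).toNat : ℤ) =
        ⌊(p i + r) / δ⌋ + 1 - ⌊(p i - r) / δ⌋ := Int.toNat_of_nonneg (by omega)
      exact_mod_cast this
    rw [h2]
    have h3 := Int.floor_le ((p i + r) / δ)
    have h4 := Int.lt_floor_add_one ((p i - r) / δ)
    have h5 : (p i + r) / δ - (p i - r) / δ = 2 * (r / δ) := by ring
    linarith
  calc (meshCount d δ E : ℝ)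
      ≤ ((P.biUnion fun p => Finset.Icc (fun i => ⌊(p i - r) / δ⌋) (fun i => ⌊(p i + r) / δ⌋) :
        Finset (Fin d → ℤ)).card : ℝ) := by
        have : meshCount d δ E ≤ _ := Set.ncard_le_ncard hB (Finset.finite_toSet _)
        rw [Set.ncard_coe_finset] at this
        exact_mod_cast this
    _ ≤ ∑ p ∈ P, ((Finset.Icc (fun i => ⌊(p i - r) / δ⌋) (fun i => ⌊(p i + r) / δ⌋) :
        Finset (Fin d → ℤ)).card : ℝ) := mod_cast Finset.card_biUnion_le
    _ ≤ ∑ p ∈ P, (2 * (r / δ) + 2) ^ d := Finset.sum_le_sum fun p _ => hcard p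
    _ = P.card * (2 * (r / δ) + 2) ^ d := by simp
    _ ≤ K * (2 * (r / δ) + 2) ^ d := by gcongr

theorem hasCover_of_meshCount {d : ℕ} {E : Set (Fin d → ℝ)} {r K δ : ℝ} (hr : 0 ≤ r) (hδ : 0 < δ)
    (h : HasCover E r K) : HasCover E δ (meshCount d δ E) := by
  classical
  have hfin := (meshSet_finite_and_meshCount_le hr hδ h).1
  refine ⟨hfin.toFinset.image fun a i => (a i : ℝ) * δ, ?_, fun x hx => ?_⟩
  · rw [meshCount, Set.ncard_eq_toFinset_card _ hfin]
    exact_mod_cast Finset.card_image_le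
  · have hfl : ∀ i, (⌊x i / δ⌋ : ℝ) * δ ≤ x i ∧ x i < ((⌊x i / δ⌋ : ℝ) + 1) * δ := fun i =>
      ⟨(le_div_iff₀ hδ).1 (Int.floor_le _), (div_lt_iff₀ hδ).1 (Int.lt_floor_add_one _)⟩
    refine ⟨fun i => (⌊x i / δ⌋ : ℝ) * δ, ?_, ?_⟩
    · exact Finset.mem_image.2 ⟨fun i => ⌊x i / δ⌋, hfin.mem_toFinset.2 ⟨x, hx, hfl⟩, rfl⟩
    · refine (dist_pi_le_iff hδ.le).2 fun i => ?_
      rw [Real.dist_eq, abs_le]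
      have := hfl i
      constructor <;> linarith

theorem Bornology.IsBounded.exists_hasCover {X : Type*} [PseudoMetricSpace X] {E : Set X}
    (h : Bornology.IsBounded E) : ∃ r, 0 ≤ r ∧ HasCover E r 1 := by
  rcases E.eq_empty_or_nonempty with rfl | ⟨x, hx⟩
  · exact ⟨0, le_rfl, ∅, by simp, by simp⟩
  · exact ⟨Metric.diam E, Metric.diam_nonneg, {x}, by simp,
      fun y hy => ⟨x, by simp, Metric.dist_le_diam_of_mem h hy hx⟩⟩

theorem eventually_box_quotient_nonneg (d : ℕ) (E : Set (Fin d → ℝ)) :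
    ∀ᶠ δ in nhdsWithin (0 : ℝ) (Set.Ioi 0),
      0 ≤ Real.log (meshCount d δ E) / (-Real.log δ) := by
  filter_upwards [Ioo_mem_nhdsGT (zero_lt_one' ℝ)] with δ hδ
  exact div_nonneg (Real.log_natCast_nonneg _) (by linarith [Real.log_neg hδ.1 hδ.2])

theorem isBoundedUnder_box_quotient {d : ℕ} {E : Set (Fin d → ℝ)} (h : Bornology.IsBounded E) :
    IsBoundedUnder (· ≤ ·) (nhdsWithin (0 : ℝ) (Set.Ioi 0))
      (fun δ : ℝ => Real.log (meshCount d δ E) / (-Real.log δ)) := by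
  obtain ⟨r, hr, hcov⟩ := h.exists_hasCover
  refine ⟨d * (Real.log (2 * r + 2) + 1), ?_⟩
  rw [eventually_map]
  filter_upwards [Ioo_mem_nhdsGT (Real.exp_pos (-1))] with δ hδ
  have hδ0 := hδ.1
  have hlog : 1 ≤ -Real.log δ := by
    have := (Real.log_lt_log hδ0 hδ.2).le
    rw [Real.log_exp] at this
    linarith
  have hδ1 : δ ≤ 1 := hδ.2.le.trans (Real.exp_le_one_iff.2 (by norm_num))
  have hlr : 0 ≤ Real.log (2 * r + 2) := Real.log_nonneg (by linarith)
  rw [div_le_iff₀ (by linarith)]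
  rcases (Nat.zero_le (meshCount d δ E)).eq_or_lt with h0 | h0
  · rw [← h0, Nat.cast_zero, Real.log_zero]
    have : (0 : ℝ) ≤ -Real.log δ := by linarith
    positivity
  · have h1 := (meshSet_finite_and_meshCount_le hr hδ0 hcov).2
    have h2 : (meshCount d δ E : ℝ) ≤ ((2 * r + 2) / δ) ^ d := by
      refine h1.trans ?_
      rw [one_mul]
      gcongr
      rw [le_div_iff₀ hδ0, add_mul, mul_assoc, div_mul_cancel₀ _ hδ0.ne']
      linarith
    have h3 := Real.log_le_log (by exact_mod_cast h0) h2
    rw [Real.log_pow, Real.log_div (by positivity) hδ0.ne'] at h3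
    refine h3.trans ?_
    rw [mul_assoc]
    gcongr
    nlinarith

theorem upperBoxDim_nonneg {d : ℕ} {E : Set (Fin d → ℝ)} (h : Bornology.IsBounded E) :
    0 ≤ upperBoxDim d E := by
  refine le_limsup_of_le (isBoundedUnder_box_quotient h) fun b hb => ?_
  obtain ⟨δ, h1, h2⟩ := (hb.and (eventually_box_quotient_nonneg d E)).exists
  exact h2.trans h1

theorem exists_hasCover_of_upperBoxDim {d : ℕ} {E : Set (Fin d → ℝ)} (h : Bornology.IsBounded E)
    {ε : ℝ} (hε : 0 < ε) :
    ∃ A : ℝ, 0 ≤ A ∧ ∀ n : ℕ,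
      HasCover E ((1 / 2 : ℝ) ^ n) (A * (2 : ℝ) ^ (n * (upperBoxDim d E + ε))) := by
  obtain ⟨r, hr, hcov⟩ := h.exists_hasCover
  have hdim := upperBoxDim_nonneg h
  have hev := eventually_lt_of_limsup_lt (f := nhdsWithin (0 : ℝ) (Set.Ioi 0))
    (u := fun δ : ℝ => Real.log (meshCount d δ E) / (-Real.log δ))
    (b := upperBoxDim d E + ε) (lt_add_of_pos_right _ hε) (isBoundedUnder_box_quotient h)
  have ht := tendsto_pow_atTop_nhdsWithin_zero_of_lt_one (r := (1 / 2 : ℝ)) (by norm_num)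
    (by norm_num)
  obtain ⟨N, hN⟩ := eventually_atTop.1 ((ht.eventually hev).and (eventually_ge_atTop 1))
  have key : ∀ n ≥ N, HasCover E ((1 / 2 : ℝ) ^ n) ((2 : ℝ) ^ (n * (upperBoxDim d E + ε))) := by
    intro n hn
    obtain ⟨h1, h2⟩ := hN n hn
    refine (hasCover_of_meshCount hr (by positivity) hcov).mono subset_rfl le_rfl ?_
    rcases (Nat.zero_le (meshCount d ((1 / 2) ^ n) E)).eq_or_lt with h0 | h0
    · rw [← h0, Nat.cast_zero]
      positivity
    · have hl2 := Real.log_pos one_lt_two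
      have hn0 : (0 : ℝ) < n := by exact_mod_cast h2
      have hlog : -Real.log ((1 / 2 : ℝ) ^ n) = n * Real.log 2 := by
        rw [Real.log_pow, one_div, Real.log_inv]
        ring
      rw [hlog, div_lt_iff₀ (by positivity)] at h1
      rw [← Real.log_le_log_iff (by exact_mod_cast h0) (by positivity), Real.log_rpow two_pos]
      linarith
  have hone : ∀ n : ℕ, 1 ≤ (2 : ℝ) ^ (n * (upperBoxDim d E + ε)) := fun n =>
    Real.one_le_rpow one_le_two (by positivity)
  refine ⟨(2 : ℝ) ^ (N * (upperBoxDim d E + ε)), by positivity, fun n => ?_⟩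
  rcases le_total N n with hn | hn
  · exact (key n hn).mono subset_rfl le_rfl
      (le_mul_of_one_le_left (by positivity) (hone N))
  · exact (key N le_rfl).mono subset_rfl
      (pow_le_pow_of_le_one (by norm_num) (by norm_num) hn)
      (le_mul_of_one_le_right (by positivity) (hone n))

theorem upperBoxDim_le_of_hasCover {d : ℕ} {E : Set (Fin d → ℝ)} {R t : ℝ} (hR : 0 ≤ R)
    (ht : 0 ≤ t)
    (h : ∀ ε > 0, ∃ A : ℝ, ∀ n : ℕ,
      HasCover E (R * (1 / 2 : ℝ) ^ n) (A * (2 : ℝ) ^ (n * (t + ε)))) :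
    upperBoxDim d E ≤ t := by
  refine le_of_forall_pos_le_add fun η hη => ?_
  obtain ⟨A₀, hA₀⟩ := h (η / 2) (half_pos hη)
  set A := max A₀ 1
  have hA : 1 ≤ A := le_max_right _ _
  have hcov : ∀ n : ℕ, HasCover E (R * (1 / 2 : ℝ) ^ n) (A * (2 : ℝ) ^ (n * (t + η / 2))) :=
    fun n => (hA₀ n).mono subset_rfl le_rfl (by gcongr; exact le_max_left _ _)
  refine limsup_le_of_le (isCoboundedUnder_le_of_eventually_le _
    (eventually_box_quotient_nonneg d E)) ?_
  set B := A * (2 : ℝ) ^ (t + η / 2) * (2 * R + 2) ^ d with hB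
  have hBpos : 0 < B := by positivity
  have hlim : ∀ᶠ δ in nhdsWithin (0 : ℝ) (Set.Ioi 0), Real.log B * (2 / η) ≤ -Real.log δ :=
    (tendsto_neg_atBot_atTop.comp Real.tendsto_log_nhdsGT_zero).eventually_ge_atTop _
  filter_upwards [Ioo_mem_nhdsGT (zero_lt_one' ℝ), hlim] with δ hδ hδB
  obtain ⟨hδ0, hδ1⟩ := hδ
  have hlogδ : 0 < -Real.log δ := by linarith [Real.log_neg hδ0 hδ1]
  rw [div_le_iff₀ hlogδ]
  rcases (Nat.zero_le (meshCount d δ E)).eq_or_lt with h0 | h0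
  · rw [← h0, Nat.cast_zero, Real.log_zero]
    positivity
  obtain ⟨n, hn1, hn2⟩ := exists_nat_pow_near_of_lt_one hδ0 hδ1.le
    (by norm_num : (0 : ℝ) < 1 / 2) (by norm_num)
  have h1 := (meshSet_finite_and_meshCount_le (by positivity) hδ0 (hcov (n + 1))).2
  have hpow : (2 : ℝ) ^ (n * (t + η / 2)) ≤ δ ^ (-(t + η / 2)) := by
    rw [Real.rpow_mul two_pos.le, Real.rpow_neg hδ0.le, ← Real.inv_rpow hδ0.le]
    refine Real.rpow_le_rpow (by positivity) ?_ (by positivity)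
    rw [Real.rpow_natCast, le_inv_comm₀ (by positivity) hδ0, ← inv_pow, ← one_div]
    exact hn2
  have h2 : (meshCount d δ E : ℝ) ≤ B * δ ^ (-(t + η / 2)) := by
    refine h1.trans ?_
    have e1 : (2 : ℝ) ^ (((n + 1 : ℕ) : ℝ) * (t + η / 2)) =
        (2 : ℝ) ^ (n * (t + η / 2)) * (2 : ℝ) ^ (t + η / 2) := by
      rw [← Real.rpow_add two_pos]
      push_cast
      ring_nf
    have e2 : R * (1 / 2) ^ (n + 1) / δ ≤ R := by
      rw [div_le_iff₀ hδ0]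
      gcongr
    calc A * (2 : ℝ) ^ (((n + 1 : ℕ) : ℝ) * (t + η / 2)) *
          (2 * (R * (1 / 2) ^ (n + 1) / δ) + 2) ^ d
        ≤ A * (δ ^ (-(t + η / 2)) * (2 : ℝ) ^ (t + η / 2)) * (2 * R + 2) ^ d := by
          rw [e1]
          gcongr
      _ = B * δ ^ (-(t + η / 2)) := by rw [hB]; ring
  have h3 := Real.log_le_log (by exact_mod_cast h0) h2
  rw [Real.log_mul hBpos.ne' (by positivity), Real.log_rpow hδ0] at h3
  have h4 : Real.log B ≤ η / 2 * -Real.log δ := by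
    have := mul_le_mul_of_nonneg_left hδB (half_pos hη).le
    rwa [show η / 2 * (Real.log B * (2 / η)) = Real.log B by field_simp] at this
  linarith

theorem exists_mul_of_eventually_le {f g : ℕ → ℝ} (hg : ∀ k, 1 ≤ g k)
    (h : ∀ᶠ k in atTop, f k ≤ g k) : ∃ A : ℝ, 0 ≤ A ∧ ∀ k, f k ≤ A * g k := by
  obtain ⟨N, hN⟩ := eventually_atTop.1 h
  have hS : 0 ≤ ∑ j ∈ Finset.range N, |f j| := Finset.sum_nonneg fun _ _ => abs_nonneg _
  refine ⟨1 + ∑ j ∈ Finset.range N, |f j|, by positivity, fun k => ?_⟩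
  have hgk := hg k
  rcases le_or_gt N k with hk | hk
  · exact (hN k hk).trans (le_mul_of_one_le_left (by linarith) (by linarith))
  · have h1 : |f k| ≤ ∑ j ∈ Finset.range N, |f j| :=
      Finset.single_le_sum (f := fun j => |f j|) (fun _ _ => abs_nonneg _) (Finset.mem_range.2 hk)
    have h2 := le_abs_self (f k)
    nlinarith

theorem natCast_add_one_le_const_mul_two_rpow {ε : ℝ} (hε : 0 < ε) (n : ℕ) :
    (n : ℝ) + 1 ≤ (1 / (ε * Real.log 2) + 1) * (2 : ℝ) ^ (n * ε) := by
  have hl := Real.log_pos one_lt_two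
  have h1 : Real.log 2 * (n * ε) + 1 ≤ (2 : ℝ) ^ (n * ε) := by
    rw [Real.rpow_def_of_pos two_pos]
    exact Real.add_one_le_exp _
  have h2 : (0 : ℝ) ≤ n * ε := by positivity
  have h3 : (n : ℝ) ≤ 1 / (ε * Real.log 2) * (2 : ℝ) ^ (n * ε) := by
    rw [div_mul_eq_mul_div, one_mul, le_div_iff₀ (by positivity)]
    nlinarith
  nlinarith [mul_nonneg hl.le h2]

theorem succ_mul_two_rpow_le {ε : ℝ} (hε : 0 < ε) (t : ℝ) (n : ℕ) :
    ((n : ℝ) + 1) * (2 : ℝ) ^ (n * t) ≤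
      (1 / (ε * Real.log 2) + 1) * (2 : ℝ) ^ (n * (t + ε)) := by
  have h := natCast_add_one_le_const_mul_two_rpow hε n
  calc ((n : ℝ) + 1) * (2 : ℝ) ^ (n * t)
      ≤ ((1 / (ε * Real.log 2) + 1) * (2 : ℝ) ^ (n * ε)) * (2 : ℝ) ^ (n * t) := by gcongr
    _ = (1 / (ε * Real.log 2) + 1) * (2 : ℝ) ^ (n * (t + ε)) := by
      rw [mul_assoc, ← Real.rpow_add two_pos, ← mul_add, add_comm ε]

section Words

variable {d m : ℕ} {c : Fin m → ℝ}

theorem wordC_cons (i : Fin m) (I : List (Fin m)) : wordC c (i :: I) = c i * wordC c I := by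
  simp [wordC]

theorem wordC_pos (hc : ∀ i, 0 < c i ∧ c i < 1) (I : List (Fin m)) : 0 < wordC c I := by
  induction I with
  | nil => simp [wordC]
  | cons i I ih => rw [wordC_cons]; exact mul_pos (hc i).1 ih

theorem exists_ratio_bound (hc : ∀ i, 0 < c i ∧ c i < 1) :
    ∃ q : ℝ, 0 < q ∧ q < 1 ∧ ∀ i, c i ≤ q := by
  rcases isEmpty_or_nonempty (Fin m) with h | h
  · exact ⟨1 / 2, by norm_num, by norm_num, fun i => h.elim i⟩
  · obtain ⟨j, hj⟩ := Finite.exists_max c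
    exact ⟨c j, (hc j).1, (hc j).2, hj⟩

theorem wordC_le_pow (hc : ∀ i, 0 < c i ∧ c i < 1) {q : ℝ} (hq : ∀ i, c i ≤ q)
    (I : List (Fin m)) : wordC c I ≤ q ^ I.length := by
  induction I with
  | nil => simp [wordC]
  | cons i I ih =>
    rw [wordC_cons, List.length_cons, pow_succ']
    exact mul_le_mul (hq i) ih (wordC_pos hc I).le ((hc i).1.le.trans (hq i))

theorem exists_forall_length_wordC_le (hc : ∀ i, 0 < c i ∧ c i < 1) {t : ℝ} (ht : 0 < t) :
    ∃ l : ℕ, ∀ I : List (Fin m), I.length = l → wordC c I ≤ t := by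
  obtain ⟨q, hq0, hq1, hq⟩ := exists_ratio_bound hc
  obtain ⟨l, hl⟩ := exists_pow_lt_of_lt_one ht hq1
  exact ⟨l, fun I hI => (wordC_le_pow hc hq I).trans (hI ▸ hl.le)⟩

theorem wordC_le_one (hc : ∀ i, 0 < c i ∧ c i < 1) (I : List (Fin m)) : wordC c I ≤ 1 := by
  simpa using wordC_le_pow hc (fun i => (hc i).2.le) I

theorem exists_mem_wordIdx (hc : ∀ i, 0 < c i ∧ c i < 1) {n : ℕ} {I : List (Fin m)}
    (hI : (1 / 2 : ℝ) ^ n < wordC c I) : ∃ k < n, I ∈ wordIdx c k := by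
  obtain ⟨k, h1, h2⟩ := exists_nat_pow_near_of_lt_one (wordC_pos hc I) (wordC_le_one hc I)
    (by norm_num : (0 : ℝ) < 1 / 2) (by norm_num)
  refine ⟨k, (pow_lt_pow_iff_right_of_lt_one₀ (by norm_num) (by norm_num)).1 (hI.trans_le h2), ?_⟩
  simpa [wordIdx] using And.intro h1 h2

/-- The words in `I_k` are finite in number, and the exponential growth rate of that number is at
most the similarity dimension. -/
theorem wordIdx_finite_and_ncard_le (hc : ∀ i, 0 < c i ∧ c i < 1) {s : ℝ} (hs0 : 0 ≤ s)
    (hs : ∑ i, c i ^ s = 1) :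
    ∃ B : ℝ, 0 ≤ B ∧ ∀ k : ℕ, (wordIdx c k).Finite ∧
      ((wordIdx c k).ncard : ℝ) ≤ B * (k + 1) * (2 : ℝ) ^ (k * s) := by
  classical
  obtain ⟨q, hq0, hq1, hq⟩ := exists_ratio_bound hc
  obtain ⟨L, hL⟩ := exists_pow_lt_of_lt_one (by norm_num : (0 : ℝ) < 1 / 2) hq1
  refine ⟨L * (2 : ℝ) ^ s, by positivity, fun k => ?_⟩
  let G : ℕ → Finset (List (Fin m)) := fun l =>
    ((Finset.univ : Finset (Fin l → Fin m)).filter fun p => List.ofFn p ∈ wordIdx c k).image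
      List.ofFn
  have hsub : wordIdx c k ⊆ (((Finset.range (L * (k + 1))).biUnion G :
      Finset (List (Fin m))) : Set (List (Fin m))) := by
    intro I hI
    simp only [Finset.coe_biUnion, Set.mem_iUnion, Finset.mem_coe, Finset.mem_range]
    refine ⟨I.length, ?_, Finset.mem_image.2
      ⟨I.get, Finset.mem_filter.2 ⟨Finset.mem_univ _, ?_⟩, List.ofFn_get I⟩⟩
    · by_contra! hlen
      have h1 : wordC c I ≤ ((2 : ℝ) ^ (k + 1))⁻¹ :=
        calc wordC c I ≤ q ^ I.length := wordC_le_pow hc hq I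
          _ ≤ q ^ (L * (k + 1)) := pow_le_pow_of_le_one hq0.le hq1.le hlen
          _ = (q ^ L) ^ (k + 1) := pow_mul _ _ _
          _ ≤ (1 / 2) ^ (k + 1) := by gcongr
          _ = ((2 : ℝ) ^ (k + 1))⁻¹ := by rw [one_div, inv_pow]
      exact absurd hI.1 (not_lt.2 h1)
    · rwa [List.ofFn_get]
  have hG : ∀ l, ((G l).card : ℝ) ≤ (2 : ℝ) ^ s * (2 : ℝ) ^ (k * s) := by
    intro l
    set W := (Finset.univ : Finset (Fin l → Fin m)).filter fun p => List.ofFn p ∈ wordIdx c k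
    have hterm : ∀ p ∈ W, ((2 : ℝ) ^ s * (2 : ℝ) ^ (k * s))⁻¹ ≤ ∏ j, c (p j) ^ s := by
      intro p hp
      have hp' := (Finset.mem_filter.1 hp).2.1
      rw [wordC, List.map_ofFn, List.prod_ofFn] at hp'
      rw [Real.finsetProd_rpow _ _ fun j _ => (hc (p j)).1.le]
      calc ((2 : ℝ) ^ s * (2 : ℝ) ^ (k * s))⁻¹ = (((2 : ℝ) ^ (k + 1))⁻¹) ^ s := by
            rw [Real.inv_rpow (by positivity), ← Real.rpow_natCast, ← Real.rpow_mul two_pos.le,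
              ← Real.rpow_add two_pos]
            push_cast
            ring_nf
        _ ≤ _ := Real.rpow_le_rpow (by positivity) hp'.le hs0
    have hsum : (W.card : ℝ) * ((2 : ℝ) ^ s * (2 : ℝ) ^ (k * s))⁻¹ ≤ 1 :=
      calc (W.card : ℝ) * ((2 : ℝ) ^ s * (2 : ℝ) ^ (k * s))⁻¹
          = ∑ p ∈ W, ((2 : ℝ) ^ s * (2 : ℝ) ^ (k * s))⁻¹ := by simp
        _ ≤ ∑ p ∈ W, ∏ j, c (p j) ^ s := Finset.sum_le_sum hterm
        _ ≤ ∑ p : Fin l → Fin m, ∏ j, c (p j) ^ s :=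
            Finset.sum_le_sum_of_subset_of_nonneg (Finset.subset_univ _) fun p _ _ =>
              Finset.prod_nonneg fun j _ => Real.rpow_nonneg (hc (p j)).1.le _
        _ = 1 := by
            rw [← Fintype.sum_pow (fun i => c i ^ s), hs, one_pow]
    rw [← div_eq_mul_inv, div_le_one (by positivity)] at hsum
    exact le_trans (mod_cast Finset.card_image_le) hsum
  refine ⟨(Finset.finite_toSet _).subset hsub, ?_⟩
  calc ((wordIdx c k).ncard : ℝ)
      ≤ (((Finset.range (L * (k + 1))).biUnion G).card : ℝ) := by
        have := Set.ncard_le_ncard hsub (Finset.finite_toSet _)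
        rw [Set.ncard_coe_finset] at this
        exact_mod_cast this
    _ ≤ ∑ l ∈ Finset.range (L * (k + 1)), ((G l).card : ℝ) := mod_cast Finset.card_biUnion_le
    _ ≤ ∑ l ∈ Finset.range (L * (k + 1)), (2 : ℝ) ^ s * (2 : ℝ) ^ (k * s) :=
        Finset.sum_le_sum fun l _ => hG l
    _ = L * (2 : ℝ) ^ s * (k + 1) * (2 : ℝ) ^ (k * s) := by
        simp
        ring

theorem exists_wordIdx_ncard_le_two_rpow (hc : ∀ i, 0 < c i ∧ c i < 1) {s : ℝ} (hs0 : 0 ≤ s)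
    (hs : ∑ i, c i ^ s = 1) {ε : ℝ} (hε : 0 < ε) :
    ∃ A : ℝ, 0 ≤ A ∧ ∀ k : ℕ, (wordIdx c k).Finite ∧
      ((wordIdx c k).ncard : ℝ) ≤ A * (2 : ℝ) ^ (k * (s + ε)) := by
  obtain ⟨B, hB, h⟩ := wordIdx_finite_and_ncard_le hc hs0 hs
  have hl := Real.log_pos one_lt_two
  refine ⟨B * (1 / (ε * Real.log 2) + 1), by positivity, fun k => ⟨(h k).1, (h k).2.trans ?_⟩⟩
  have h1 := mul_le_mul_of_nonneg_left (succ_mul_two_rpow_le hε s k) hB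
  linarith

theorem Tmaps_finite (M : Fin m → Matrix (Fin d) (Fin d) ℝ) {k : ℕ} (h : (wordIdx c k).Finite) :
    (Tmaps d m c M k).Finite := by
  refine (h.image fun I => fun x : Fin d → ℝ => wordC c I • (wordM M I).mulVec x).subset ?_
  rintro f ⟨I, hI, rfl⟩
  exact ⟨I, hI, rfl⟩

theorem exists_Tmaps_ncard_le (M : Fin m → Matrix (Fin d) (Fin d) ℝ)
    (hγ : limsup (fun k : ℕ => ((Tmaps d m c M k).ncard : ℝ) ^ (1 / (k : ℝ))) atTop = 1)
    {ε : ℝ} (hε : 0 < ε) :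
    ∃ A : ℝ, 0 ≤ A ∧ ∀ k : ℕ, ((Tmaps d m c M k).ncard : ℝ) ≤ A * (2 : ℝ) ^ (k * ε) := by
  have hbdd : IsBoundedUnder (· ≤ ·) atTop
      (fun k : ℕ => ((Tmaps d m c M k).ncard : ℝ) ^ (1 / (k : ℝ))) := by
    by_contra hne
    have : {a | ∀ᶠ k : ℕ in atTop, ((Tmaps d m c M k).ncard : ℝ) ^ (1 / (k : ℝ)) ≤ a} = ∅ := by
      refine Set.eq_empty_of_forall_notMem fun a ha => hne ⟨a, ?_⟩
      rw [eventually_map]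
      exact ha
    rw [limsup_eq, this, Real.sInf_empty] at hγ
    exact zero_ne_one hγ
  refine exists_mul_of_eventually_le (fun k => Real.one_le_rpow one_le_two (by positivity)) ?_
  have hev := eventually_lt_of_limsup_lt
    (hγ.trans_lt (Real.one_lt_rpow one_lt_two hε)) hbdd
  filter_upwards [hev, eventually_ge_atTop 1] with k hk hk1
  have hk0 : (k : ℝ) ≠ 0 := by
    have : k ≠ 0 := by omega
    exact_mod_cast this
  calc ((Tmaps d m c M k).ncard : ℝ)
      = (((Tmaps d m c M k).ncard : ℝ) ^ (1 / (k : ℝ))) ^ (k : ℝ) := by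
        rw [← Real.rpow_mul (by positivity), one_div_mul_cancel hk0, Real.rpow_one]
    _ ≤ ((2 : ℝ) ^ ε) ^ (k : ℝ) := Real.rpow_le_rpow (by positivity) hk.le (by positivity)
    _ = (2 : ℝ) ^ (k * ε) := by rw [← Real.rpow_mul two_pos.le, mul_comm]

variable {M : Fin m → Matrix (Fin d) (Fin d) ℝ} {b : Fin m → (Fin d → ℝ)}
  {S : Fin m → (Fin d → ℝ) → (Fin d → ℝ)}

theorem norm_mulVec_le_of_mem_orthogonalGroup {A : Matrix (Fin d) (Fin d) ℝ}
    (hA : A ∈ Matrix.orthogonalGroup (Fin d) ℝ) (x : Fin d → ℝ) : ‖A.mulVec x‖ ≤ d * ‖x‖ := by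
  refine (pi_norm_le_iff_of_nonneg (by positivity)).2 fun i => ?_
  calc ‖A.mulVec x i‖ ≤ ∑ j, ‖A i j * x j‖ := norm_sum_le Finset.univ fun j => A i j * x j
    _ ≤ ∑ _j : Fin d, ‖x‖ := Finset.sum_le_sum fun j _ => by
        rw [norm_mul]
        exact (mul_le_of_le_one_left (norm_nonneg _) (entry_norm_bound_of_unitary hA i j)).trans
          (norm_le_pi_norm x j)
    _ = d * ‖x‖ := by simp

theorem wordM_mem_orthogonalGroup (hM : ∀ i, M i ∈ Matrix.orthogonalGroup (Fin d) ℝ)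
    (I : List (Fin m)) : wordM M I ∈ Matrix.orthogonalGroup (Fin d) ℝ := by
  refine Submonoid.list_prod_mem _ fun A hA => ?_
  obtain ⟨i, -, rfl⟩ := List.mem_map.1 hA
  exact hM i

theorem wordS_cons {X : Type*} (T : Fin m → X → X) (i : Fin m) (I : List (Fin m)) (x : X) :
    wordS T (i :: I) x = T i (wordS T I x) := rfl

theorem wordS_sub (hS : ∀ i x, S i x = c i • (M i).mulVec x + b i) (I : List (Fin m))
    (x y : Fin d → ℝ) :
    wordS S I x - wordS S I y =
      wordC c I • (wordM M I).mulVec x - wordC c I • (wordM M I).mulVec y := by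
  rw [← smul_sub, ← Matrix.mulVec_sub]
  induction I with
  | nil => simp [wordS, wordC, wordM]
  | cons i I ih =>
    have hMI : wordM M (i :: I) = M i * wordM M I := by simp [wordM]
    rw [wordS_cons, wordS_cons, hS, hS, add_sub_add_right_eq_sub, ← smul_sub,
      ← Matrix.mulVec_sub, ih, wordC_cons, hMI, ← Matrix.mulVec_mulVec, Matrix.mulVec_smul,
      smul_smul]

theorem dist_linear_part_le (hc : ∀ i, 0 < c i ∧ c i < 1)
    (hM : ∀ i, M i ∈ Matrix.orthogonalGroup (Fin d) ℝ) (I : List (Fin m)) (x y : Fin d → ℝ) :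
    dist (wordC c I • (wordM M I).mulVec x) (wordC c I • (wordM M I).mulVec y) ≤
      d * wordC c I * dist x y := by
  have hI := wordC_pos hc I
  rw [dist_eq_norm, dist_eq_norm, ← smul_sub, ← Matrix.mulVec_sub, norm_smul,
    Real.norm_of_nonneg hI.le]
  have := norm_mulVec_le_of_mem_orthogonalGroup (wordM_mem_orthogonalGroup hM I) (x - y)
  calc wordC c I * ‖(wordM M I).mulVec (x - y)‖ ≤ wordC c I * (d * ‖x - y‖) := by gcongr
    _ = d * wordC c I * ‖x - y‖ := by ring

theorem dist_wordS_le (hc : ∀ i, 0 < c i ∧ c i < 1)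
    (hM : ∀ i, M i ∈ Matrix.orthogonalGroup (Fin d) ℝ)
    (hS : ∀ i x, S i x = c i • (M i).mulVec x + b i) (I : List (Fin m)) (x y : Fin d → ℝ) :
    dist (wordS S I x) (wordS S I y) ≤ d * wordC c I * dist x y := by
  have := dist_linear_part_le hc hM I x y
  rwa [dist_eq_norm, ← wordS_sub hS, ← dist_eq_norm] at this

theorem wordS_mem {X : Type*} {T : Fin m → X → X} {F : Set X} (hF : F = ⋃ i, T i '' F)
    (I : List (Fin m)) {x : X} (hx : x ∈ F) : wordS T I x ∈ F := by
  induction I with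
  | nil => exact hx
  | cons i I ih =>
    rw [wordS_cons, hF]
    exact Set.mem_iUnion.2 ⟨i, Set.mem_image_of_mem _ ih⟩

theorem exists_wordS_of_mem_inhomogeneous {X : Type*} {T : Fin m → X → X} {F C : Set X}
    (hF : F = (⋃ i, T i '' F) ∪ C) (l : ℕ) {x : X} (hx : x ∈ F) :
    (∃ I, x ∈ wordS T I '' C) ∨ ∃ I : List (Fin m), I.length = l ∧ x ∈ wordS T I '' F := by
  induction l generalizing x with
  | zero => exact Or.inr ⟨[], rfl, x, hx, rfl⟩
  | succ l ih =>
    rw [hF] at hx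
    rcases hx with hx | hx
    · obtain ⟨i, y, hy, rfl⟩ := Set.mem_iUnion.1 hx
      rcases ih hy with ⟨I, z, hz, rfl⟩ | ⟨I, hI, z, hz, rfl⟩
      · exact Or.inl ⟨i :: I, z, hz, rfl⟩
      · exact Or.inr ⟨i :: I, by simp [hI], z, hz, rfl⟩
    · exact Or.inl ⟨[], x, hx, rfl⟩

/-- Every point of a self-similar set lies in a cylinder whose ratio is comparable to `t`. -/
theorem exists_cylinder_at_scale (hc : ∀ i, 0 < c i ∧ c i < 1) {κ : ℝ}
    (hκ : ∀ i, κ ≤ c i) {X : Type*} {T : Fin m → X → X} {F : Set X} (hF : F = ⋃ i, T i '' F)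
    {t : ℝ} (ht0 : 0 < t) (ht1 : t < 1) {x : X} (hx : x ∈ F) :
    ∃ I : List (Fin m), t < wordC c I ∧ wordC c I * κ ≤ t ∧ x ∈ wordS T I '' F := by
  obtain ⟨q, hq0, hq1, hq⟩ := exists_ratio_bound hc
  obtain ⟨l, hl⟩ := exists_pow_lt_of_lt_one ht0 hq1
  induction l generalizing t x with
  | zero => rw [pow_zero] at hl; linarith
  | succ l ih =>
    rcases le_or_gt κ t with hκt | hκt
    · exact ⟨[], by simpa [wordC], by simpa [wordC], x, hx, rfl⟩
    rw [hF] at hx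
    obtain ⟨i, y, hy, rfl⟩ := Set.mem_iUnion.1 hx
    have hci := (hc i).1
    have hlt : q ^ l < t / c i := by
      rw [lt_div_iff₀ hci]
      refine lt_of_le_of_lt ?_ hl
      rw [pow_succ]
      gcongr
      exact hq i
    obtain ⟨I, h1, h2, z, hz, rfl⟩ := ih (t := t / c i) (by positivity)
      ((div_lt_one hci).2 (hκt.trans_le (hκ i))) hy hlt
    rw [div_lt_iff₀' hci] at h1
    rw [le_div_iff₀' hci, ← mul_assoc] at h2
    exact ⟨i :: I, by rwa [wordC_cons], by rwa [wordC_cons], z, hz, rfl⟩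

theorem upperBoxDim_le_similarityDim (hm : 0 < m) (hc : ∀ i, 0 < c i ∧ c i < 1)
    (hM : ∀ i, M i ∈ Matrix.orthogonalGroup (Fin d) ℝ)
    (hS : ∀ i x, S i x = c i • (M i).mulVec x + b i) {F : Set (Fin d → ℝ)} (hFne : F.Nonempty)
    (hFb : Bornology.IsBounded F) (hF : F = ⋃ i, S i '' F) {s : ℝ} (hs0 : 0 ≤ s)
    (hs : ∑ i, c i ^ s = 1) : upperBoxDim d F ≤ s := by
  classical
  obtain ⟨x₀, hx₀⟩ := hFne
  have : Nonempty (Fin m) := ⟨⟨0, hm⟩⟩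
  obtain ⟨j, hj⟩ := Finite.exists_min c
  have hκ0 := (hc j).1
  have hD := Metric.diam_nonneg (s := F)
  refine upperBoxDim_le_of_hasCover (R := d * (c j)⁻¹ * Metric.diam F) (by positivity) hs0
    fun ε hε => ?_
  obtain ⟨A, hA, hcard⟩ := exists_wordIdx_ncard_le_two_rpow hc hs0 hs (half_pos hε)
  refine ⟨A * (1 / (ε / 2 * Real.log 2) + 1), fun n => ?_⟩
  set r : ℝ := d * (c j)⁻¹ * Metric.diam F * (1 / 2 : ℝ) ^ n with hr
  have hcov : ∀ k ∈ Finset.range (n + 1),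
      HasCover {x | ∃ I ∈ wordIdx c k, dist x (wordS S I x₀) ≤ r} r
        (A * (2 : ℝ) ^ (n * (s + ε / 2))) := by
    intro k hk
    obtain ⟨hfin, hle⟩ := hcard k
    refine ⟨hfin.toFinset.image fun I => wordS S I x₀, ?_, ?_⟩
    · have h1 : ((hfin.toFinset.image fun I => wordS S I x₀).card : ℝ) ≤
          (wordIdx c k).ncard := by
        rw [Set.ncard_eq_toFinset_card _ hfin]
        exact_mod_cast Finset.card_image_le
      refine h1.trans (hle.trans ?_)
      have hkn : (k : ℝ) ≤ n := by exact_mod_cast Nat.lt_succ_iff.1 (Finset.mem_range.1 hk)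
      gcongr
      exact one_le_two
    · rintro x ⟨I, hI, hd⟩
      exact ⟨_, Finset.mem_image_of_mem _ (hfin.mem_toFinset.2 hI), hd⟩
  refine (HasCover.biUnion _ hcov).mono ?_ le_rfl ?_
  · intro x hx
    obtain ⟨I, h1, h2, z, hz, rfl⟩ := exists_cylinder_at_scale hc hj hF
      (t := (1 / 2 : ℝ) ^ (n + 1)) (by positivity)
      (pow_lt_one₀ (by norm_num) (by norm_num) (by omega)) hx
    obtain ⟨k, hk, hIk⟩ := exists_mem_wordIdx hc h1
    refine Set.mem_biUnion (Finset.mem_coe.2 (Finset.mem_range.2 hk)) ⟨I, hIk, ?_⟩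
    have h3 : wordC c I ≤ (c j)⁻¹ * (1 / 2 : ℝ) ^ n := by
      rw [← div_eq_inv_mul, le_div_iff₀ hκ0]
      exact h2.trans (pow_le_pow_of_le_one (by norm_num) (by norm_num) (by omega))
    calc dist (wordS S I z) (wordS S I x₀) ≤ d * wordC c I * dist z x₀ :=
          dist_wordS_le hc hM hS _ _ _
      _ ≤ d * ((c j)⁻¹ * (1 / 2 : ℝ) ^ n) * Metric.diam F := by
          gcongr
          exact Metric.dist_le_diam_of_mem hFb hz hx₀
      _ = r := by rw [hr]; ring
  · have h1 := mul_le_mul_of_nonneg_left (succ_mul_two_rpow_le (half_pos hε) (s + ε / 2) n) hA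
    rw [add_assoc s, add_halves] at h1
    rw [Finset.card_range]
    push_cast
    linarith

theorem wordC_le_half_pow {k : ℕ} {I : List (Fin m)} (hI : I ∈ wordIdx c k) :
    wordC c I ≤ (1 / 2 : ℝ) ^ k := by
  simpa using hI.2

theorem dist_linear_part_le_of_mem_wordIdx (hc : ∀ i, 0 < c i ∧ c i < 1)
    (hM : ∀ i, M i ∈ Matrix.orthogonalGroup (Fin d) ℝ) {k n : ℕ} (hkn : k ≤ n)
    {I : List (Fin m)} (hI : I ∈ wordIdx c k) {x y : Fin d → ℝ}
    (hxy : dist x y ≤ (1 / 2 : ℝ) ^ (n - k)) :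
    dist (wordC c I • (wordM M I).mulVec x) (wordC c I • (wordM M I).mulVec y) ≤
      d * (1 / 2 : ℝ) ^ n :=
  calc _ ≤ d * wordC c I * dist x y := dist_linear_part_le hc hM I x y
    _ ≤ d * (1 / 2 : ℝ) ^ k * (1 / 2 : ℝ) ^ (n - k) := by
        have := wordC_le_half_pow hI
        gcongr
    _ = d * (1 / 2 : ℝ) ^ n := by rw [mul_assoc, pow_mul_pow_sub _ hkn]

/-- Covering the level-`k` copies of `C` one word at a time. -/
theorem hasCover_level_of_wordIdx (hc : ∀ i, 0 < c i ∧ c i < 1)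
    (hM : ∀ i, M i ∈ Matrix.orthogonalGroup (Fin d) ℝ)
    (hS : ∀ i x, S i x = c i • (M i).mulVec x + b i) {C : Set (Fin d → ℝ)} {k n : ℕ} (hkn : k ≤ n)
    (hfin : (wordIdx c k).Finite) {K : ℝ} (hC : HasCover C ((1 / 2 : ℝ) ^ (n - k)) K) :
    HasCover (⋃ I ∈ wordIdx c k, wordS S I '' C) (d * (1 / 2 : ℝ) ^ n)
      ((wordIdx c k).ncard * K) := by
  classical
  obtain ⟨P, hP, hcov⟩ := hC
  have h : ∀ I ∈ hfin.toFinset, HasCover (wordS S I '' C) (d * (1 / 2 : ℝ) ^ n) K := by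
    refine fun I hI => ⟨P.image (wordS S I), ?_, ?_⟩
    · exact le_trans (mod_cast Finset.card_image_le) hP
    · rintro _ ⟨x, hx, rfl⟩
      obtain ⟨p, hp, hd⟩ := hcov x hx
      refine ⟨_, Finset.mem_image_of_mem _ hp, ?_⟩
      rw [dist_eq_norm, wordS_sub hS, ← dist_eq_norm]
      exact dist_linear_part_le_of_mem_wordIdx hc hM hkn (hfin.mem_toFinset.1 hI) hd
  refine (HasCover.biUnion _ h).mono ?_ le_rfl ?_
  · intro x hx
    obtain ⟨I, hI, hxI⟩ := Set.mem_iUnion₂.1 hx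
    exact Set.mem_biUnion (Finset.mem_coe.2 (hfin.mem_toFinset.2 hI)) hxI
  · rw [Set.ncard_eq_toFinset_card _ hfin]

/-- Covering the level-`k` copies of `C` by grouping the words with the same linear part. -/
theorem hasCover_level_of_Tmaps (hc : ∀ i, 0 < c i ∧ c i < 1)
    (hM : ∀ i, M i ∈ Matrix.orthogonalGroup (Fin d) ℝ)
    (hS : ∀ i x, S i x = c i • (M i).mulVec x + b i) {F C : Set (Fin d → ℝ)}
    (hFne : F.Nonempty) (hF : F = ⋃ i, S i '' F) {k n : ℕ} (hkn : k ≤ n)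
    (hfin : (wordIdx c k).Finite) {K L : ℝ} (hK : 0 ≤ K)
    (hC : HasCover C ((1 / 2 : ℝ) ^ (n - k)) K) (hFcov : HasCover F ((1 / 2 : ℝ) ^ n) L) :
    HasCover (⋃ I ∈ wordIdx c k, wordS S I '' C) ((d + 1) * (1 / 2 : ℝ) ^ n)
      ((Tmaps d m c M k).ncard * (K * L)) := by
  classical
  obtain ⟨x₀, hx₀⟩ := hFne
  obtain ⟨P, hP, hcov⟩ := hC
  obtain ⟨Q, hQ, hcovF⟩ := hFcov
  have hT := Tmaps_finite M hfin
  have h : ∀ f ∈ hT.toFinset,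
      HasCover {x | ∃ I ∈ wordIdx c k, (f = fun y => wordC c I • (wordM M I).mulVec y) ∧
        x ∈ wordS S I '' C} ((d + 1) * (1 / 2 : ℝ) ^ n) (K * L) := by
    refine fun f _ => ⟨(P ×ˢ Q).image fun pq => f pq.1 - f x₀ + pq.2, ?_, ?_⟩
    · calc (((P ×ˢ Q).image fun pq => f pq.1 - f x₀ + pq.2).card : ℝ)
          ≤ ((P ×ˢ Q).card : ℝ) := mod_cast Finset.card_image_le
        _ = P.card * Q.card := by rw [Finset.card_product]; push_cast; rfl
        _ ≤ K * L := mul_le_mul hP hQ (Nat.cast_nonneg _) hK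
    · rintro _ ⟨I, hI, rfl, x, hx, rfl⟩
      obtain ⟨p, hp, hpd⟩ := hcov x hx
      obtain ⟨z, hz, hzd⟩ := hcovF _ (wordS_mem hF I hx₀)
      refine ⟨_, Finset.mem_image_of_mem _ (Finset.mk_mem_product hp hz), ?_⟩
      rw [← sub_add_cancel (wordS S I x) (wordS S I x₀), wordS_sub hS, add_mul, one_mul]
      refine (dist_add_add_le _ _ _ _).trans (add_le_add ?_ hzd)
      rw [dist_sub_right]
      exact dist_linear_part_le_of_mem_wordIdx hc hM hkn hI hpd
  refine (HasCover.biUnion _ h).mono ?_ le_rfl ?_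
  · intro x hx
    obtain ⟨I, hI, hxI⟩ := Set.mem_iUnion₂.1 hx
    exact Set.mem_biUnion (Finset.mem_coe.2 (hT.mem_toFinset.2 ⟨I, hI, rfl⟩)) ⟨I, hI, rfl, hxI⟩
  · rw [Set.ncard_eq_toFinset_card _ hT]

/-- Cylinders of `F'` at scale at most `2^{-n}` are covered by covering `F` at that scale. -/
theorem hasCover_small_cylinders (hc : ∀ i, 0 < c i ∧ c i < 1)
    (hM : ∀ i, M i ∈ Matrix.orthogonalGroup (Fin d) ℝ)
    (hS : ∀ i x, S i x = c i • (M i).mulVec x + b i) {F F' : Set (Fin d → ℝ)}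
    (hF : F = ⋃ i, S i '' F) {x₀ : Fin d → ℝ} (hx₀ : x₀ ∈ F) {D : ℝ}
    (hD : ∀ x ∈ F', dist x x₀ ≤ D) {n : ℕ} {L : ℝ} (hFcov : HasCover F ((1 / 2 : ℝ) ^ n) L) :
    HasCover {x | ∃ I, wordC c I ≤ (1 / 2 : ℝ) ^ n ∧ x ∈ wordS S I '' F'}
      ((d * D + 1) * (1 / 2 : ℝ) ^ n) L := by
  obtain ⟨Q, hQ, hcov⟩ := hFcov
  refine ⟨Q, hQ, ?_⟩
  rintro _ ⟨I, hI, x, hx, rfl⟩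
  obtain ⟨z, hz, hzd⟩ := hcov _ (wordS_mem hF I hx₀)
  refine ⟨z, hz, ?_⟩
  have hIpos := wordC_pos hc I
  calc dist (wordS S I x) z ≤ dist (wordS S I x) (wordS S I x₀) + dist (wordS S I x₀) z :=
        dist_triangle _ _ _
    _ ≤ d * wordC c I * dist x x₀ + (1 / 2 : ℝ) ^ n :=
        add_le_add (dist_wordS_le hc hM hS _ _ _) hzd
    _ ≤ d * (1 / 2 : ℝ) ^ n * D + (1 / 2 : ℝ) ^ n := by
        have := hD x hx
        gcongr
    _ = (d * D + 1) * (1 / 2 : ℝ) ^ n := by ring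

theorem inhomogeneous_subset_levels (hc : ∀ i, 0 < c i ∧ c i < 1) {X : Type*}
    {T : Fin m → X → X} {F C : Set X} (hF : F = (⋃ i, T i '' F) ∪ C) (n : ℕ) :
    F ⊆ (⋃ k ∈ Finset.range n, ⋃ I ∈ wordIdx c k, wordS T I '' C) ∪
      {x | ∃ I, wordC c I ≤ (1 / 2 : ℝ) ^ n ∧ x ∈ wordS T I '' F} := by
  intro x hx
  obtain ⟨l, hl⟩ := exists_forall_length_wordC_le hc
    (pow_pos (by norm_num : (0 : ℝ) < 1 / 2) n)
  rcases exists_wordS_of_mem_inhomogeneous hF l hx with ⟨I, hI⟩ | ⟨I, hlen, hI⟩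
  · rcases le_or_gt (wordC c I) ((1 / 2 : ℝ) ^ n) with h | h
    · exact Or.inr ⟨I, h, Set.image_mono (hF ▸ Set.subset_union_right) hI⟩
    · obtain ⟨k, hk, hIk⟩ := exists_mem_wordIdx hc h
      exact Or.inl (Set.mem_biUnion (Finset.mem_coe.2 (Finset.mem_range.2 hk))
        (Set.mem_biUnion hIk hI))
  · exact Or.inr ⟨I, hl I hlen, hI⟩

end Words

theorem le_max_exponent {s α β : ℝ} (hαs : α ≤ s) (hβ : 0 ≤ β) :
    α ≤ max β (α + β - α * β / s) := by
  rcases le_or_gt s β with h | h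
  · exact le_max_of_le_left (hαs.trans h)
  · refine le_max_of_le_right ?_
    have hs : 0 < s := hβ.trans_lt h
    have : α * β / s ≤ β := by
      rw [div_le_iff₀ hs, mul_comm β]
      gcongr
    linarith

theorem level_exponent_le {s α β : ℝ} (hβ : 0 ≤ β) {k n : ℝ}
    (hk : 0 ≤ k) (hn : 0 ≤ n) :
    k * s + (n - k) * β ≤ n * max β (α + β - α * β / s) ∨
      (n - k) * β + n * α ≤ n * max β (α + β - α * β / s) := by
  rcases le_or_gt s β with h | h
  · left
    have := mul_le_mul_of_nonneg_left (le_max_left β (α + β - α * β / s)) hn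
    nlinarith
  have hs : 0 < s := hβ.trans_lt h
  have ht := mul_le_mul_of_nonneg_left (le_max_right β (α + β - α * β / s)) hn
  have e : n * (α + β - α * β / s) = n * β + n * α / s * (s - β) := by
    field_simp
    ring
  rw [e] at ht
  have e' : n * α / s * s = n * α := div_mul_cancel₀ _ hs.ne'
  rcases le_total k (n * α / s) with h' | h'
  · left
    have := mul_le_mul_of_nonneg_right h' (sub_nonneg.2 h.le)
    linarith
  · right
    have := mul_le_mul_of_nonneg_right h' hβ
    linarith

/-- Corollary 5.10: if `γ = 0` (which holds whenever the orthogonal parts commute, or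
`d = 1`, or `d = 2`), then the upper box dimension of `F_C` is at most
`max{β, α + β - αβ/s}`. -/
theorem upper_bound_gamma_zero (d m : ℕ) (hm : 0 < m) (c : Fin m → ℝ)
    (M : Fin m → Matrix (Fin d) (Fin d) ℝ) (b : Fin m → (Fin d → ℝ))
    (hc : ∀ i, 0 < c i ∧ c i < 1)
    (hM : ∀ i, M i ∈ Matrix.orthogonalGroup (Fin d) ℝ)
    (S : Fin m → (Fin d → ℝ) → (Fin d → ℝ))
    (hS : ∀ i x, S i x = c i • (M i).mulVec x + b i)
    (C F₀ FC : Set (Fin d → ℝ)) (hCcpt : IsCompact C)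
    (hF₀ne : F₀.Nonempty) (hF₀cpt : IsCompact F₀) (hF₀ : F₀ = ⋃ i, S i '' F₀)
    (hFCne : FC.Nonempty) (hFCcpt : IsCompact FC) (hFC : FC = (⋃ i, S i '' FC) ∪ C)
    (s α β γ : ℝ)
    (hs0 : 0 ≤ s) (hs : ∑ i, c i ^ s = 1)
    (hα : α = upperBoxDim d F₀) (hβ : β = upperBoxDim d C)
    (hγ : limsup (fun k : ℕ => ((Tmaps d m c M k).ncard : ℝ) ^ (1 / (k : ℝ))) atTop
      = (2 : ℝ) ^ γ)
    (hγ0 : γ = 0) :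
    upperBoxDim d FC ≤ max β (α + β - α * β / s) := by
  classical
  subst hγ0
  rw [Real.rpow_zero] at hγ
  have hα0 : 0 ≤ α := hα ▸ upperBoxDim_nonneg hF₀cpt.isBounded
  have hβ0 : 0 ≤ β := hβ ▸ upperBoxDim_nonneg hCcpt.isBounded
  have hαs : α ≤ s :=
    hα ▸ upperBoxDim_le_similarityDim hm hc hM hS hF₀ne hF₀cpt.isBounded hF₀ hs0 hs
  obtain ⟨x₀, hx₀⟩ := hF₀ne
  obtain ⟨D₀, hD₀⟩ := hFCcpt.isBounded.subset_closedBall x₀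
  set D := max D₀ 0
  have hD0 : 0 ≤ D := le_max_right _ _
  have hD : ∀ x ∈ FC, dist x x₀ ≤ D := fun x hx => (hD₀ hx).trans (le_max_left _ _)
  have hd0 : (0 : ℝ) ≤ d := d.cast_nonneg
  have hdD : 0 ≤ d * D := mul_nonneg hd0 hD0
  set t := max β (α + β - α * β / s)
  have hαt : α ≤ t := le_max_exponent hαs hβ0
  refine upperBoxDim_le_of_hasCover (R := d + 1 + d * D) (by positivity) (hα0.trans hαt)
    fun η hη => ?_
  obtain ⟨ε, hε, rfl⟩ : ∃ ε : ℝ, 0 < ε ∧ η = 2 * ε + ε := ⟨η / 3, by positivity, by ring⟩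
  obtain ⟨A₁, hA₁, hC⟩ := exists_hasCover_of_upperBoxDim hCcpt.isBounded hε
  obtain ⟨A₂, hA₂, hF⟩ := exists_hasCover_of_upperBoxDim hF₀cpt.isBounded hε
  obtain ⟨A₃, hA₃, hT⟩ := exists_Tmaps_ncard_le M hγ hε
  obtain ⟨A₄, hA₄, hI⟩ := exists_wordIdx_ncard_le_two_rpow hc hs0 hs hε
  rw [← hβ] at hC
  rw [← hα] at hF
  set A := A₄ * A₁ + A₃ * (A₁ * A₂) + A₂
  have hA : 0 ≤ A := by positivity
  refine ⟨A * (1 / (ε * Real.log 2) + 1), fun n => ?_⟩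
  have hmono : ∀ {B e : ℝ}, B ≤ A → e ≤ n * (t + 2 * ε) →
      B * (2 : ℝ) ^ e ≤ A * (2 : ℝ) ^ (n * (t + 2 * ε)) := by
    intro B e hB he
    gcongr
    exact one_le_two
  have hlevel : ∀ k ∈ Finset.range n, HasCover (⋃ I ∈ wordIdx c k, wordS S I '' C)
      ((d + 1 + d * D) * (1 / 2 : ℝ) ^ n) (A * (2 : ℝ) ^ (n * (t + 2 * ε))) := by
    intro k hk
    have hkn : k ≤ n := (Finset.mem_range.1 hk).le
    have hknR : (k : ℝ) ≤ n := by exact_mod_cast hkn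
    have hkε : (k : ℝ) * ε ≤ n * ε := by gcongr
    have hk0 : (0 : ℝ) ≤ k * ε := by positivity
    have hCk := hC (n - k)
    rw [Nat.cast_sub hkn] at hCk
    rcases level_exponent_le (s := s) hβ0 k.cast_nonneg n.cast_nonneg with he | he
    · refine (hasCover_level_of_wordIdx hc hM hS hkn (hI k).1 hCk).mono subset_rfl ?_ ?_
      · exact mul_le_mul_of_nonneg_right (by linarith) (by positivity)
      · calc ((wordIdx c k).ncard : ℝ) * (A₁ * (2 : ℝ) ^ (((n : ℝ) - k) * (β + ε)))
            ≤ A₄ * (2 : ℝ) ^ (k * (s + ε)) * (A₁ * (2 : ℝ) ^ (((n : ℝ) - k) * (β + ε))) := by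
              gcongr
              exact (hI k).2
          _ = A₄ * A₁ * (2 : ℝ) ^ (k * (s + ε) + ((n : ℝ) - k) * (β + ε)) := by
              rw [Real.rpow_add two_pos]
              ring
          _ ≤ _ := by
              refine hmono ?_ (by linarith)
              have : 0 ≤ A₃ * (A₁ * A₂) := by positivity
              linarith
    · refine (hasCover_level_of_Tmaps hc hM hS ⟨x₀, hx₀⟩ hF₀ hkn (hI k).1 (by positivity) hCk
        (hF n)).mono subset_rfl ?_ ?_
      · exact mul_le_mul_of_nonneg_right (by linarith) (by positivity)
      · calc ((Tmaps d m c M k).ncard : ℝ) * (A₁ * (2 : ℝ) ^ (((n : ℝ) - k) * (β + ε)) *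
              (A₂ * (2 : ℝ) ^ (n * (α + ε))))
            ≤ A₃ * (2 : ℝ) ^ (k * ε) * (A₁ * (2 : ℝ) ^ (((n : ℝ) - k) * (β + ε)) *
              (A₂ * (2 : ℝ) ^ (n * (α + ε)))) := by
              gcongr
              exact hT k
          _ = A₃ * (A₁ * A₂) *
              (2 : ℝ) ^ (k * ε + (((n : ℝ) - k) * (β + ε) + n * (α + ε))) := by
              rw [Real.rpow_add two_pos, Real.rpow_add two_pos]
              ring
          _ ≤ _ := by
              refine hmono ?_ (by linarith)
              have : 0 ≤ A₄ * A₁ := by positivity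
              linarith
  have hsmall : HasCover {x | ∃ I, wordC c I ≤ (1 / 2 : ℝ) ^ n ∧ x ∈ wordS S I '' FC}
      ((d + 1 + d * D) * (1 / 2 : ℝ) ^ n) (A * (2 : ℝ) ^ (n * (t + 2 * ε))) := by
    refine (hasCover_small_cylinders hc hM hS hF₀ hx₀ hD (hF n)).mono subset_rfl ?_ ?_
    · exact mul_le_mul_of_nonneg_right (by linarith) (by positivity)
    · refine hmono ?_ ?_
      · have : 0 ≤ A₄ * A₁ + A₃ * (A₁ * A₂) := by positivity
        linarith
      · gcongr
        linarith
  refine ((HasCover.biUnion _ hlevel).union hsmall).mono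
    (inhomogeneous_subset_levels hc hFC n) le_rfl ?_
  have := mul_le_mul_of_nonneg_left (succ_mul_two_rpow_le hε (t + 2 * ε) n) hA
  rw [add_assoc t] at this
  rw [Finset.card_range]
  linarith
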